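/- arXiv:2603.17819 — 3 statements merged into one kernel-verified Lean document; each statement's English description precedes it below -/
import Mathlib

section
/- Let B = (β_n)_{n∈ℤ} be a Cantor real base and for each n ∈ ℤ let 𝐚_n = a_{n,1}a_{n,2}⋯ be a sequence of nonnegative integers ending in a tail of zeros such that val_{S^n(B)}(0·𝐚_n) = 1 and a_{n,j+1}a_{n,j+2}⋯ <_lex 𝐚_{n-j} for all j ≥ 1. Then for every n ∈ ℤ, 𝐚_n is the lexicographically greatest sequence 𝐛 of nonnegative integers with val_{S^n(B)}(0·𝐛) = 1, i.e., 𝐚_n = 𝐭_n. -/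
open Filter

/-- A Cantor real base: all entries `> 1`, with both one-sided partial products tending to `+∞`. -/
def IsCantorBase (B : ℤ → ℝ) : Prop :=
  (∀ n, 1 < B n) ∧
  Tendsto (fun N : ℕ => ∏ i ∈ Finset.range N, B (i + 1)) atTop atTop ∧
  Tendsto (fun N : ℕ => ∏ i ∈ Finset.range N, B (-(i + 1))) atTop atTop

/-- `valS B n a = val_{S^n(B)}(0 · a)`, where `a j` is the `(j+1)`-st digit. -/
noncomputable def valS (B : ℤ → ℝ) (n : ℤ) (a : ℕ → ℕ) : ℝ :=
  ∑' j : ℕ, (a j : ℝ) / ∏ i ∈ Finset.range (j + 1), B (n - 1 - i)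

/-- Strict lexicographic order on one-sided digit sequences. -/
def lexLt (x y : ℕ → ℕ) : Prop := ∃ j, (∀ i < j, x i = y i) ∧ x j < y j

def lexLe (x y : ℕ → ℕ) : Prop := x = y ∨ lexLt x y

/-- The sequence ends in a tail of zeros. -/
def EvZero (x : ℕ → ℕ) : Prop := ∃ N, ∀ j ≥ N, x j = 0

/-- `t` is the greedy `S^n(B)`-expansion of `1`: it is lexicographically greatest among
sequences of nonnegative integers with value `1`. -/
def IsGreedyOne (B : ℤ → ℝ) (n : ℤ) (t : ℕ → ℕ) : Prop :=
  valS B n t = 1 ∧ ∀ b : ℕ → ℕ, valS B n b = 1 → lexLe b t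

/-- `d` is the quasi-greedy `S^n(B)`-expansion of `1`: it is lexicographically greatest among
sequences of nonnegative integers not ending in a tail of zeros with value `1`. -/
def IsQuasiGreedyOne (B : ℤ → ℝ) (n : ℤ) (d : ℕ → ℕ) : Prop :=
  ¬ EvZero d ∧ valS B n d = 1 ∧
    ∀ b : ℕ → ℕ, ¬ EvZero b → valS B n b = 1 → lexLe b d

/-- The summand of `valS`. -/
noncomputable def digitTerm (B : ℤ → ℝ) (n : ℤ) (x : ℕ → ℕ) (j : ℕ) : ℝ :=
  (x j : ℝ) / ∏ i ∈ Finset.range (j + 1), B (n - 1 - i)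

theorem prod_base_pos {B : ℤ → ℝ} (hB : ∀ n, 1 < B n) (n : ℤ) (k : ℕ) :
    0 < ∏ i ∈ Finset.range k, B (n - 1 - i) :=
  Finset.prod_pos fun _ _ => one_pos.trans (hB _)

theorem digitTerm_nonneg {B : ℤ → ℝ} (hB : ∀ n, 1 < B n) (n : ℤ) (x : ℕ → ℕ) (j : ℕ) :
    0 ≤ digitTerm B n x j :=
  div_nonneg (Nat.cast_nonneg _) (prod_base_pos hB n _).le

theorem digitTerm_add (B : ℤ → ℝ) (n : ℤ) (x : ℕ → ℕ) (j k : ℕ) :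
    digitTerm B n x (j + k) =
      (∏ i ∈ Finset.range k, B (n - 1 - i))⁻¹ * digitTerm B (n - k) (fun m => x (m + k)) j := by
  have h : ∀ i : ℕ, B (n - 1 - ((k + i : ℕ) : ℤ)) = B (n - k - 1 - i) := fun i => by
    congr 1; push_cast; ring
  unfold digitTerm
  rw [show j + k + 1 = k + (j + 1) by ring, Finset.prod_range_add]
  simp only [h]
  rw [div_mul_eq_div_div_swap, div_eq_inv_mul]

theorem valS_eq_sum_add {B : ℤ → ℝ} {n : ℤ} {x : ℕ → ℕ} (hx : Summable (digitTerm B n x))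
    (k : ℕ) :
    valS B n x = ∑ j ∈ Finset.range k, digitTerm B n x j +
      (∏ i ∈ Finset.range k, B (n - 1 - i))⁻¹ * valS B (n - k) (fun m => x (m + k)) := by
  have h := hx.sum_add_tsum_nat_add k
  simp only [digitTerm_add, tsum_mul_left] at h
  exact h.symm

theorem EvZero.summable_digitTerm {x : ℕ → ℕ} (hx : EvZero x) (B : ℤ → ℝ) (n : ℤ) :
    Summable (digitTerm B n x) := by
  obtain ⟨N, hN⟩ := hx
  refine summable_of_ne_finset_zero (s := Finset.range N) fun j hj => ?_
  simp [digitTerm, hN j (by simpa using hj)]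

/-- If `x <_lex y` and the tail of `x` after the first difference has value less than `1`,
then `x` has smaller value than `y`. -/
theorem valS_lt_valS {B : ℤ → ℝ} (hB : ∀ n, 1 < B n) {n : ℤ} {x y : ℕ → ℕ}
    (hx : Summable (digitTerm B n x)) (hy : Summable (digitTerm B n y)) {k : ℕ}
    (heq : ∀ i < k, x i = y i) (hlt : x k < y k)
    (htail : valS B (n - (k + 1 : ℕ)) (fun m => x (m + (k + 1))) < 1) :
    valS B n x < valS B n y := by
  have hP := inv_pos.2 (prod_base_pos hB n (k + 1))
  have hy0 : 0 ≤ valS B (n - (k + 1 : ℕ)) (fun m => y (m + (k + 1))) :=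
    tsum_nonneg (digitTerm_nonneg hB (n - (k + 1 : ℕ)) fun m => y (m + (k + 1)))
  have hsum : ∑ j ∈ Finset.range k, digitTerm B n x j =
      ∑ j ∈ Finset.range k, digitTerm B n y j :=
    Finset.sum_congr rfl fun j hj => by rw [digitTerm, digitTerm, heq j (Finset.mem_range.1 hj)]
  have hc : (x k : ℝ) + 1 ≤ y k := by exact_mod_cast hlt
  rw [valS_eq_sum_add hx (k + 1), valS_eq_sum_add hy (k + 1), Finset.sum_range_succ,
    Finset.sum_range_succ, hsum]
  simp only [digitTerm, div_eq_inv_mul]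
  nlinarith [mul_le_mul_of_nonneg_left hc hP.le, mul_lt_mul_of_pos_left htail hP,
    mul_nonneg hP.le hy0]

/-- A finite sequence all of whose shifts are lexicographically smaller than the corresponding
expansions of `1` has value less than `1`. -/
theorem valS_lt_one_of_lexLt {B : ℤ → ℝ} (hB : ∀ n, 1 < B n) {a : ℤ → ℕ → ℕ}
    (hz : ∀ n, EvZero (a n)) (hval : ∀ n, valS B n (a n) = 1) (N : ℕ) :
    ∀ (n : ℤ) (c : ℕ → ℕ), (∀ j ≥ N, c j = 0) →
      (∀ i : ℕ, lexLt (fun m => c (m + i)) (a (n - i))) → valS B n c < 1 := by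
  induction N using Nat.strong_induction_on with
  | _ N ih =>
    intro n c hN hc
    rcases Nat.eq_zero_or_pos N with rfl | hpos
    · simp [valS, hN]
    obtain ⟨k, heq, hlt⟩ := hc 0
    simp only [Nat.cast_zero, sub_zero, add_zero] at heq hlt
    rw [← hval n]
    refine valS_lt_valS hB (EvZero.summable_digitTerm ⟨N, hN⟩ B n)
      ((hz n).summable_digitTerm B n) heq hlt ?_
    refine ih (N - (k + 1)) (by omega) _ _ (fun j hj => hN _ (by omega)) fun i => ?_
    have h := hc (i + (k + 1))
    rw [show n - ((i + (k + 1) : ℕ) : ℤ) = n - ((k + 1 : ℕ) : ℤ) - i by push_cast; ring] at h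
    simpa only [add_assoc] using h

theorem lexLe_or_lexLt (x y : ℕ → ℕ) : lexLe x y ∨ lexLt y x := by
  classical
  by_cases h : x = y
  · exact .inl (.inl h)
  have hex : ∃ k, x k ≠ y k := Function.ne_iff.1 h
  have hmin : ∀ i < Nat.find hex, x i = y i := fun i hi => not_not.1 (Nat.find_min hex hi)
  rcases (Nat.find_spec hex).lt_or_gt with hlt | hlt
  · exact .inl (.inr ⟨_, hmin, hlt⟩)
  · exact .inr ⟨_, fun i hi => (hmin i hi).symm, hlt⟩

theorem stmt3 (B : ℤ → ℝ) (hB : IsCantorBase B) (a : ℤ → ℕ → ℕ)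
    (hz : ∀ n : ℤ, EvZero (a n))
    (hval : ∀ n : ℤ, valS B n (a n) = 1)
    (hcond : ∀ n : ℤ, ∀ j : ℕ, 1 ≤ j → lexLt (fun m => a n (m + j)) (a (n - j))) :
    ∀ n : ℤ, IsGreedyOne B n (a n) := by
  intro n
  refine ⟨hval n, fun b hb => (lexLe_or_lexLt b (a n)).resolve_right ?_⟩
  rintro ⟨k, heq, hlt⟩
  have hbs : Summable (digitTerm B n b) := by
    by_contra h
    exact zero_ne_one ((tsum_eq_zero_of_not_summable h).symm.trans hb)
  obtain ⟨N, hN⟩ := hz n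
  refine (valS_lt_valS hB.1 ((hz n).summable_digitTerm B n) hbs heq hlt ?_).ne
    ((hval n).trans hb.symm)
  refine valS_lt_one_of_lexLt hB.1 hz hval N _ _ (fun j hj => hN _ (by omega)) fun i => ?_
  have h := hcond n (i + (k + 1)) (by omega)
  rw [show n - ((i + (k + 1) : ℕ) : ℤ) = n - ((k + 1 : ℕ) : ℤ) - i by push_cast; ring] at h
  simpa only [add_assoc] using h
end

section
/- Let p ≥ 1 be an integer and let B = (β_{p−1},…,β_0) and Γ = (γ_{p−1},…,γ_0) be alternate bases of length p. Suppose that for every i ∈ {0,…,p−1} there is a sequence 𝐭_i of nonnegative integers whose first digit is at least 2, which is simultaneously the greedy S^i(B)-expansion of 1 and the greedy S^i(Γ)-expansion of 1. Then γ_i = β_i for all i ∈ {0,…,p−1}. The same conclusion holds with 'quasi-greedy' in place of 'greedy' (i.e., if for every i there is a sequence 𝐝_i with first digit at least 2, not ending in a tail of zeros, which is simultaneously the quasi-greedy S^i(B)-expansion and the quasi-greedy S^i(Γ)-expansion of 1, then Γ = B). -/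
/-- The terms of the series defining `valS`. -/
noncomputable def valTerm (B : ℤ → ℝ) (n : ℤ) (a : ℕ → ℕ) (j : ℕ) : ℝ :=
  (a j : ℝ) / ∏ i ∈ Finset.range (j + 1), B (n - 1 - i)

lemma valS_eq_tsum (B : ℤ → ℝ) (n : ℤ) (a : ℕ → ℕ) : valS B n a = ∑' j, valTerm B n a j := rfl

lemma valTerm_nonneg {B : ℤ → ℝ} (hB : ∀ n, 1 < B n) (n : ℤ) (a : ℕ → ℕ) (j : ℕ) :
    0 ≤ valTerm B n a j :=
  div_nonneg (Nat.cast_nonneg _) (Finset.prod_nonneg fun i _ => by linarith [hB (n - 1 - i)])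

lemma valS_nonneg {B : ℤ → ℝ} (hB : ∀ n, 1 < B n) (n : ℤ) (a : ℕ → ℕ) : 0 ≤ valS B n a :=
  tsum_nonneg (valTerm_nonneg hB n a)

lemma valTerm_succ (B : ℤ → ℝ) (n : ℤ) (a : ℕ → ℕ) (j : ℕ) :
    valTerm B n a (j + 1) = valTerm B (n - 1) (fun i => a (i + 1)) j / B (n - 1) := by
  have h : ∀ i : ℕ, n - 1 - ((i + 1 : ℕ) : ℤ) = n - 1 - 1 - i := fun i => by push_cast; ring
  simp only [valTerm]
  rw [Finset.prod_range_succ']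
  simp only [h, Nat.cast_zero, sub_zero, div_div]

lemma summable_valTerm_tail_iff {B : ℤ → ℝ} (hB : ∀ n, 1 < B n) (n : ℤ) (a : ℕ → ℕ) :
    Summable (valTerm B (n - 1) fun i => a (i + 1)) ↔ Summable (valTerm B n a) := by
  have hne : B (n - 1) ≠ 0 := by linarith [hB (n - 1)]
  rw [← summable_nat_add_iff 1 (f := valTerm B n a)]
  simp only [valTerm_succ]
  exact (summable_div_const_iff hne).symm

lemma valS_eq_head_add_tail {B : ℤ → ℝ} {n : ℤ} {a : ℕ → ℕ} (ha : Summable (valTerm B n a)) :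
    valS B n a = (a 0 + valS B (n - 1) fun i => a (i + 1)) / B (n - 1) := by
  rw [valS_eq_tsum, ha.tsum_eq_zero_add]
  simp only [valTerm_succ, tsum_div_const, ← valS_eq_tsum]
  simp [valTerm, add_div]

lemma summable_of_valS_eq_one {B : ℤ → ℝ} {n : ℤ} {a : ℕ → ℕ} (h : valS B n a = 1) :
    Summable (valTerm B n a) := by
  by_contra hs
  rw [valS_eq_tsum, tsum_eq_zero_of_not_summable hs] at h
  exact zero_ne_one h

lemma eq_zero_of_valS_eq_zero {B : ℤ → ℝ} (hB : ∀ n, 1 < B n) {n : ℤ} {a : ℕ → ℕ}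
    (ha : Summable (valTerm B n a)) (h : valS B n a = 0) (j : ℕ) : a j = 0 := by
  have hsum : HasSum (valTerm B n a) 0 := by
    rw [← h]
    exact ha.hasSum
  have hj := congrFun ((hasSum_zero_iff_of_nonneg (valTerm_nonneg hB n a)).1 hsum) j
  have hpos : (∏ i ∈ Finset.range (j + 1), B (n - 1 - i)) ≠ 0 :=
    (Finset.prod_pos fun i _ => by linarith [hB (n - 1 - i)]).ne'
  simpa [valTerm, hpos] using hj

lemma summable_valTerm_drop {B : ℤ → ℝ} (hB : ∀ n, 1 < B n) {n : ℤ} {a : ℕ → ℕ}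
    (ha : Summable (valTerm B n a)) (k : ℕ) :
    Summable (valTerm B (n - k) fun j => a (j + k)) := by
  induction k with
  | zero => simpa using ha
  | succ k ih =>
    have := (summable_valTerm_tail_iff hB _ _).2 ih
    simpa [add_assoc, add_comm 1 k, sub_sub] using this

lemma valS_drop {B : ℤ → ℝ} (hB : ∀ n, 1 < B n) {n : ℤ} {a : ℕ → ℕ}
    (ha : Summable (valTerm B n a)) (k : ℕ) :
    valS B (n - k) (fun j => a (j + k)) =
      (a k + valS B (n - (k + 1 : ℕ)) fun j => a (j + (k + 1))) / B (n - k - 1) := by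
  have := valS_eq_head_add_tail (summable_valTerm_drop hB ha k)
  simpa [add_assoc, add_comm 1 k, sub_sub] using this

/-- Remainders of the quasi-greedy algorithm started at `x`. -/
noncomputable def quasiRem (B : ℤ → ℝ) (n : ℤ) (x : ℝ) : ℕ → ℝ
  | 0 => x
  | k + 1 => B (n - 1 - k) * quasiRem B n x k - (⌈B (n - 1 - k) * quasiRem B n x k⌉₊ - 1 : ℕ)

lemma sub_natCeil_sub_one_mem {y : ℝ} (hy : 0 < y) :
    0 < y - (⌈y⌉₊ - 1 : ℕ) ∧ y - (⌈y⌉₊ - 1 : ℕ) ≤ 1 := by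
  have h1 : 1 ≤ ⌈y⌉₊ := Nat.one_le_iff_ne_zero.2 (Nat.ceil_pos.2 hy).ne'
  rw [Nat.cast_sub h1]
  have h2 := Nat.le_ceil y
  have h3 := Nat.ceil_lt_add_one hy.le
  push_cast
  constructor <;> linarith

lemma quasiRem_pos {B : ℤ → ℝ} (hB : ∀ n, 1 < B n) (n : ℤ) {x : ℝ} (hx : 0 < x) (k : ℕ) :
    0 < quasiRem B n x k := by
  induction k with
  | zero => exact hx
  | succ k ih => exact (sub_natCeil_sub_one_mem (mul_pos (by linarith [hB (n - 1 - k)]) ih)).1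

lemma quasiRem_le {B : ℤ → ℝ} (hB : ∀ n, 1 < B n) (n : ℤ) {x : ℝ} (hx : 0 < x) (k : ℕ) :
    quasiRem B n x k ≤ max x 1 := by
  cases k with
  | zero => exact le_max_left _ _
  | succ k =>
    exact (sub_natCeil_sub_one_mem (mul_pos (by linarith [hB (n - 1 - k)])
      (quasiRem_pos hB n hx k))).2.trans (le_max_right _ _)

/-- Every positive real has an expansion not ending in a tail of zeros. -/
lemma exists_expansion {B : ℤ → ℝ} {c : ℝ} (hc : 1 < c) (hcB : ∀ n, c ≤ B n) (n : ℤ) {x : ℝ}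
    (hx : 0 < x) : ∃ b : ℕ → ℕ, ¬ EvZero b ∧ Summable (valTerm B n b) ∧ valS B n b = x := by
  have hB : ∀ n, 1 < B n := fun n => hc.trans_le (hcB n)
  let r := quasiRem B n x
  let b : ℕ → ℕ := fun k => ⌈B (n - 1 - k) * r k⌉₊ - 1
  let P : ℕ → ℝ := fun N => ∏ i ∈ Finset.range N, B (n - 1 - i)
  have hP : ∀ N, 0 < P N := fun N => Finset.prod_pos fun i _ => by linarith [hB (n - 1 - i)]
  have hr : ∀ N, 0 < r N := quasiRem_pos hB n hx
  have hpartial : ∀ N, ∑ j ∈ Finset.range N, valTerm B n b j = x - r N / P N := by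
    intro N
    induction N with
    | zero => simp [P, r, quasiRem]
    | succ N ih =>
      have hstep : r (N + 1) = B (n - 1 - N) * r N - b N := rfl
      have hprod : P (N + 1) = P N * B (n - 1 - N) := Finset.prod_range_succ _ _
      have hterm : valTerm B n b N = b N / P (N + 1) := rfl
      have h1 := (hP N).ne'
      have h2 : B (n - 1 - N) ≠ 0 := by linarith [hB (n - 1 - N)]
      rw [Finset.sum_range_succ, ih, hstep, hterm, hprod]
      field_simp
      ring
  have hpow : ∀ N, c ^ N ≤ P N := fun N => by
    simpa using Finset.prod_le_prod (s := Finset.range N) (f := fun _ => c)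
      (fun _ _ => by linarith) (fun i _ => hcB (n - 1 - i))
  have hlim : Filter.Tendsto (fun N => r N / P N) Filter.atTop (nhds 0) := by
    have hup : Filter.Tendsto (fun N : ℕ => max x 1 / c ^ N) Filter.atTop (nhds 0) :=
      Filter.Tendsto.const_div_atTop (tendsto_pow_atTop_atTop_of_one_lt hc) _
    refine squeeze_zero (fun N => (div_pos (hr N) (hP N)).le) (fun N => ?_) hup
    exact div_le_div₀ (by positivity) (quasiRem_le hB n hx N) (by positivity) (hpow N)
  have hsum : HasSum (valTerm B n b) x := by
    rw [hasSum_iff_tendsto_nat_of_nonneg (valTerm_nonneg hB n b)]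
    simp only [hpartial]
    simpa using hlim.const_sub x
  refine ⟨b, ?_, hsum.summable, hsum.tsum_eq⟩
  rintro ⟨N, hN⟩
  have hfin : HasSum (valTerm B n b) (∑ j ∈ Finset.range N, valTerm B n b j) :=
    hasSum_sum_of_ne_finset_zero fun j hj => by
      simp [valTerm, hN j (by simpa using hj)]
  have := hsum.unique hfin
  rw [hpartial] at this
  linarith [div_pos (hr N) (hP N)]

/-- Prepend a digit. -/
def consDigit (d : ℕ) (e : ℕ → ℕ) : ℕ → ℕ
  | 0 => d
  | j + 1 => e j

lemma not_evZero_consDigit (d : ℕ) {e : ℕ → ℕ} (he : ¬ EvZero e) : ¬ EvZero (consDigit d e) :=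
  fun ⟨N, hN⟩ => he ⟨N, fun j hj => hN (j + 1) (by omega)⟩

/-- If some proper tail of `t` has value greater than `1`, then `t` is not lexicographically
greatest among the sequences with the same value. -/
lemma exists_lexLt_of_one_lt_valS_drop {B : ℤ → ℝ} {c : ℝ} (hc : 1 < c) (hcB : ∀ n, c ≤ B n)
    (m : ℕ) : ∀ (n : ℤ) (t : ℕ → ℕ), Summable (valTerm B n t) →
      1 < valS B (n - (m + 1 : ℕ)) (fun j => t (j + (m + 1))) →
      ∃ b, ¬ EvZero b ∧ Summable (valTerm B n b) ∧ valS B n b = valS B n t ∧ lexLt t b := by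
  have hB : ∀ n, 1 < B n := fun n => hc.trans_le (hcB n)
  induction m with
  | zero =>
    intro n t ht h
    simp only [zero_add, Nat.cast_one] at h
    obtain ⟨e, he, hes, hev⟩ := exists_expansion hc hcB (n - 1) (sub_pos.2 h)
    have hs : Summable (valTerm B n (consDigit (t 0 + 1) e)) :=
      (summable_valTerm_tail_iff hB n (consDigit (t 0 + 1) e)).1 hes
    refine ⟨_, not_evZero_consDigit _ he, hs, ?_, 0, by simp, Nat.lt_succ_self _⟩
    rw [valS_eq_head_add_tail hs, valS_eq_head_add_tail ht]
    simp only [consDigit]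
    rw [hev]
    push_cast
    ring
  | succ m ih =>
    intro n t ht h
    have hindex : n - 1 - ((m + 1 : ℕ) : ℤ) = n - ((m + 1 + 1 : ℕ) : ℤ) := by push_cast; ring
    obtain ⟨e, he, hes, hev, k, hk, hlt⟩ := ih (n - 1) (fun j => t (j + 1))
      ((summable_valTerm_tail_iff hB n t).2 ht) (by rw [hindex]; exact h)
    have hs : Summable (valTerm B n (consDigit (t 0) e)) :=
      (summable_valTerm_tail_iff hB n (consDigit (t 0) e)).1 hes
    refine ⟨_, not_evZero_consDigit _ he, hs, ?_, k + 1, ?_, hlt⟩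
    · rw [valS_eq_head_add_tail hs, valS_eq_head_add_tail ht]
      simp only [consDigit]
      rw [hev]
    · rintro (_ | i) hi
      · rfl
      · exact hk i (by omega)

lemma not_lexLe_of_lexLt {x y : ℕ → ℕ} (h : lexLt x y) : ¬ lexLe y x := by
  obtain ⟨j, hj, hlt⟩ := h
  rintro (rfl | ⟨k, hk, hlt'⟩)
  · exact hlt.false
  · rcases lt_trichotomy j k with h | rfl | h
    · exact hlt.ne (hk j h).symm
    · exact hlt.not_gt hlt'
    · exact hlt'.ne (hj k h).symm

lemma valS_drop_le_one {B : ℤ → ℝ} {c : ℝ} (hc : 1 < c) (hcB : ∀ n, c ≤ B n) {n : ℤ} {t : ℕ → ℕ}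
    (h1 : valS B n t = 1) (hmax : ∀ b, ¬ EvZero b → valS B n b = 1 → lexLe b t) (k : ℕ) :
    valS B (n - k) (fun j => t (j + k)) ≤ 1 := by
  cases k with
  | zero => simpa using h1.le
  | succ m =>
    by_contra! h
    obtain ⟨b, hb, -, hv, hlt⟩ :=
      exists_lexLt_of_one_lt_valS_drop hc hcB m n t (summable_of_valS_eq_one h1) h
    exact not_lexLe_of_lexLt hlt (hmax b hb (hv.trans h1))

lemma eq_emod_of_periodic {α : Type*} {p : ℕ} {f : ℤ → α} (hf : ∀ n, f (n + p) = f n) (n : ℤ) :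
    f n = f (n % p) := by
  have h : Function.Periodic f (p : ℤ) := hf
  have := h.int_mul (n / p) (n % p)
  rwa [Int.cast_id, mul_comm, Int.emod_add_mul_ediv] at this

lemma exists_nat_lt_eq_emod {p : ℕ} (hp : 1 ≤ p) (n : ℤ) : ∃ i < p, (i : ℤ) = n % p := by
  have h0 := Int.emod_nonneg n (b := p) (by omega)
  have h1 := Int.emod_lt_of_pos n (b := p) (by omega)
  exact ⟨(n % p).toNat, by omega, by omega⟩

lemma exists_forall_le_of_periodic {p : ℕ} (hp : 1 ≤ p) {f : ℤ → ℝ} (hf : ∀ n, f (n + p) = f n) :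
    ∃ m, ∀ n, f m ≤ f n := by
  obtain ⟨m, -, hm⟩ := Finset.exists_min_image (Finset.range p) (fun i : ℕ => f i)
    ⟨0, Finset.mem_range.2 hp⟩
  refine ⟨m, fun n => ?_⟩
  obtain ⟨i, hi, hin⟩ := exists_nat_lt_eq_emod hp n
  rw [eq_emod_of_periodic hf n, ← hin]
  exact hm i (Finset.mem_range.2 hi)

lemma valS_periodic {p : ℕ} {B : ℤ → ℝ} (hB : ∀ n, B (n + p) = B n) (a : ℕ → ℕ) (n : ℤ) :
    valS B (n + p) a = valS B n a := by
  have h : ∀ i : ℕ, B (n + p - 1 - i) = B (n - 1 - i) := fun i => by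
    rw [← hB (n - 1 - i)]
    congr 1
    ring
  simp only [valS, h]

/-- Two alternate bases coincide if, for every shift, a common sequence with first digit at least
`2` represents `1` and has all its tails of value at most `1`. -/
lemma eq_of_common_expansions {p : ℕ} (hp : 1 ≤ p) {β γ : ℤ → ℝ}
    (hβ1 : ∀ n, 1 < β n) (hβper : ∀ n, β (n + p) = β n)
    (hγ1 : ∀ n, 1 < γ n) (hγper : ∀ n, γ (n + p) = γ n) {t : ℤ → ℕ → ℕ}
    (ht : ∀ n, 2 ≤ t n 0) (hβt : ∀ n, valS β n (t n) = 1) (hγt : ∀ n, valS γ n (t n) = 1)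
    (hβle : ∀ n (k : ℕ), valS β (n - k) (fun j => t n (j + k)) ≤ 1)
    (hγle : ∀ n (k : ℕ), valS γ (n - k) (fun j => t n (j + k)) ≤ 1) (n : ℤ) : γ n = β n := by
  let U : ℤ → ℕ → ℝ := fun n k => valS β (n - k) (fun j => t n (j + k))
  let V : ℤ → ℕ → ℝ := fun n k => valS γ (n - k) (fun j => t n (j + k))
  have hU0 : ∀ n k, 0 ≤ U n k := fun n k => valS_nonneg hβ1 _ _
  have hV0 : ∀ n k, 0 ≤ V n k := fun n k => valS_nonneg hγ1 _ _
  have hU1 : ∀ n k, U n k ≤ 1 := hβle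
  have hV1 : ∀ n k, V n k ≤ 1 := hγle
  have hsβ n := summable_of_valS_eq_one (hβt n)
  have hsγ n := summable_of_valS_eq_one (hγt n)
  have hUrec : ∀ n (k : ℕ), U n k * β (n - k - 1) = t n k + U n (k + 1) := fun n k => by
    have hne : β (n - k - 1) ≠ 0 := by linarith [hβ1 (n - k - 1)]
    exact (eq_div_iff hne).1 (valS_drop hβ1 (hsβ n) k)
  have hVrec : ∀ n (k : ℕ), V n k * γ (n - k - 1) = t n k + V n (k + 1) := fun n k => by
    have hne : γ (n - k - 1) ≠ 0 := by linarith [hγ1 (n - k - 1)]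
    exact (eq_div_iff hne).1 (valS_drop hγ1 (hsγ n) k)
  have hβU : ∀ n, β n = t (n + 1) 0 + U (n + 1) 1 := fun n => by
    have h0 : U (n + 1) 0 = 1 := by simpa [U] using hβt (n + 1)
    simpa [h0] using hUrec (n + 1) 0
  have hγV : ∀ n, γ n = t (n + 1) 0 + V (n + 1) 1 := fun n => by
    have h0 : V (n + 1) 0 = 1 := by simpa [V] using hγt (n + 1)
    simpa [h0] using hVrec (n + 1) 0
  have ht' : ∀ n, (2 : ℝ) ≤ t n 0 := fun n => by exact_mod_cast ht n
  have hβ2 : ∀ n, 2 ≤ β n := fun n => by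
    rw [hβU]
    linarith [ht' (n + 1), hU0 (n + 1) 1]
  have hβ2γ : ∀ n, β n = 2 → γ n = β n := fun n h => by
    have hzero : U (n + 1) 1 = 0 := by
      linarith [hβU n, ht' (n + 1), hU0 (n + 1) 1]
    have hdig := eq_zero_of_valS_eq_zero hβ1 (summable_valTerm_drop hβ1 (hsβ (n + 1)) 1) hzero
    have hV : V (n + 1) 1 = 0 := by
      simp only [V, valS, hdig]
      simp
    rw [hβU, hγV, hzero, hV]
  obtain ⟨m, hm⟩ := exists_forall_le_of_periodic hp (f := fun n => -|γ n - β n|)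
    fun n => by rw [hβper, hγper]
  simp only [neg_le_neg_iff] at hm
  set M := |γ m - β m| with hM
  have hM0 : 0 ≤ M := abs_nonneg _
  have hdiff : ∀ n (k : ℕ), |V n k - U n k| * β (n - k - 1) ≤
      |V n (k + 1) - U n (k + 1)| + |γ (n - k - 1) - β (n - k - 1)| := fun n k => by
    have hpos : 0 < β (n - k - 1) := by linarith [hβ1 (n - k - 1)]
    have hrec : (V n k - U n k) * β (n - k - 1) =
        (V n (k + 1) - U n (k + 1)) - V n k * (γ (n - k - 1) - β (n - k - 1)) := by
      linarith [hUrec n k, hVrec n k]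
    calc |V n k - U n k| * β (n - k - 1)
        = |(V n (k + 1) - U n (k + 1)) - V n k * (γ (n - k - 1) - β (n - k - 1))| := by
          rw [← hrec, abs_mul, abs_of_pos hpos]
      _ ≤ |V n (k + 1) - U n (k + 1)| + |V n k * (γ (n - k - 1) - β (n - k - 1))| := abs_sub _ _
      _ ≤ _ := by
          rw [abs_mul, abs_of_nonneg (hV0 n k)]
          gcongr
          exact mul_le_of_le_one_left (abs_nonneg _) (hV1 n k)
  let f : ℤ × ℕ → ℝ := fun q => |V q.1 q.2 - U q.1 q.2|
  have hbdd : BddAbove (Set.range f) := by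
    refine ⟨1, ?_⟩
    rintro _ ⟨⟨n, k⟩, rfl⟩
    exact abs_le.2 ⟨by linarith [hV0 n k, hU1 n k], by linarith [hU0 n k, hV1 n k]⟩
  have hsup : ⨆ q, f q ≤ M := by
    have : ⨆ q, f q ≤ ((⨆ q, f q) + M) / 2 := ciSup_le fun ⟨n, k⟩ => by
      have h1 := hdiff n k
      have h2 : f (n, k + 1) ≤ ⨆ q, f q := le_ciSup hbdd _
      have h3 := mul_le_mul_of_nonneg_left (hβ2 (n - k - 1)) (abs_nonneg (V n k - U n k))
      have h4 := hm (n - k - 1)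
      simp only [f] at h2 ⊢
      linarith
    linarith
  have hfM : ∀ n k, |V n k - U n k| ≤ M := fun n k => (le_ciSup hbdd (n, k)).trans hsup
  have hmax := hdiff (m + 1) 1
  have hMeq : |V (m + 1) 1 - U (m + 1) 1| = M := by
    rw [hM, hβU, hγV, add_sub_add_left_eq_sub]
  rw [hMeq] at hmax
  have hnext := hfM (m + 1) (1 + 1)
  set l : ℤ := m + 1 - (1 : ℕ) - 1
  have hMzero : M = 0 := by
    refine le_antisymm ?_ hM0
    rcases (hβ2 l).eq_or_lt with h | h
    · rw [hβ2γ l h.symm, ← h, sub_self, abs_zero] at hmax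
      linarith
    · by_contra! hpos
      nlinarith [hm l]
  exact sub_eq_zero.1 (abs_eq_zero.1 (le_antisymm ((hm n).trans hMzero.le) (abs_nonneg _)))

/-- Two alternate bases coincide if, for every shift, a common sequence with first digit at least
`2` represents `1` and dominates all expansions of `1` not ending in a tail of zeros. -/
lemma eq_of_common_dominating_expansions {p : ℕ} (hp : 1 ≤ p) {β γ : ℤ → ℝ}
    (hβ1 : ∀ n, 1 < β n) (hβper : ∀ n, β (n + p) = β n)
    (hγ1 : ∀ n, 1 < γ n) (hγper : ∀ n, γ (n + p) = γ n)
    (h : ∀ i : ℕ, i < p → ∃ t : ℕ → ℕ, 2 ≤ t 0 ∧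
      (valS β i t = 1 ∧ ∀ b, ¬ EvZero b → valS β i b = 1 → lexLe b t) ∧
      (valS γ i t = 1 ∧ ∀ b, ¬ EvZero b → valS γ i b = 1 → lexLe b t)) (n : ℤ) : γ n = β n := by
  have hall : ∀ n : ℤ, ∃ t : ℕ → ℕ, 2 ≤ t 0 ∧
      (valS β n t = 1 ∧ ∀ b, ¬ EvZero b → valS β n b = 1 → lexLe b t) ∧
      (valS γ n t = 1 ∧ ∀ b, ¬ EvZero b → valS γ n b = 1 → lexLe b t) := fun n => by
    obtain ⟨i, hi, hin⟩ := exists_nat_lt_eq_emod hp n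
    have hβn a : valS β n a = valS β i a := by
      rw [hin]
      exact eq_emod_of_periodic (f := fun n => valS β n a) (valS_periodic hβper a) n
    have hγn a : valS γ n a = valS γ i a := by
      rw [hin]
      exact eq_emod_of_periodic (f := fun n => valS γ n a) (valS_periodic hγper a) n
    simp only [hβn, hγn]
    exact h i hi
  choose t ht hβt hγt using hall
  obtain ⟨k, hk⟩ := exists_forall_le_of_periodic hp hβper
  obtain ⟨l, hl⟩ := exists_forall_le_of_periodic hp hγper
  exact eq_of_common_expansions hp hβ1 hβper hγ1 hγper ht (fun n => (hβt n).1) (fun n => (hγt n).1)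
    (fun n => valS_drop_le_one (hβ1 k) hk (hβt n).1 (hβt n).2)
    (fun n => valS_drop_le_one (hγ1 l) hl (hγt n).1 (hγt n).2) n

theorem stmt7 (p : ℕ) (hp : 1 ≤ p) (β γ : ℤ → ℝ)
    (hβ1 : ∀ n, 1 < β n) (hβper : ∀ n, β (n + p) = β n)
    (hγ1 : ∀ n, 1 < γ n) (hγper : ∀ n, γ (n + p) = γ n) :
    ((∀ i : ℕ, i < p → ∃ t : ℕ → ℕ, 2 ≤ t 0 ∧ IsGreedyOne β i t ∧ IsGreedyOne γ i t) →
        ∀ i : ℕ, i < p → γ i = β i) ∧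
    ((∀ i : ℕ, i < p → ∃ d : ℕ → ℕ, 2 ≤ d 0 ∧ IsQuasiGreedyOne β i d ∧ IsQuasiGreedyOne γ i d) →
        ∀ i : ℕ, i < p → γ i = β i) := by
  refine ⟨fun h i _ => ?_, fun h i _ => ?_⟩
  · refine eq_of_common_dominating_expansions hp hβ1 hβper hγ1 hγper (fun j hj => ?_) i
    obtain ⟨t, ht, hβt, hγt⟩ := h j hj
    exact ⟨t, ht, ⟨hβt.1, fun b _ => hβt.2 b⟩, ⟨hγt.1, fun b _ => hγt.2 b⟩⟩
  · refine eq_of_common_dominating_expansions hp hβ1 hβper hγ1 hγper (fun j hj => ?_) i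
    obtain ⟨d, hd, hβd, hγd⟩ := h j hj
    exact ⟨d, hd, hβd.2, hγd.2⟩
end

section
/- Let k ≥ 1 and let (A_n)_{n∈ℤ} be a sequence of k×k matrices with nonnegative integer entries such that (A_n)_{1,1} ≥ 1 for all n ∈ ℤ, and such that there exist a k×k matrix P with all entries positive and indices i_1 < j_1 ≤ i_2 < j_2 ≤ ⋯ in ℕ with A_{j_r−1}⋯A_{i_r} = P for every r ≥ 1. Then there exist unique sequences (γ_n)_{n∈ℤ} of positive real numbers and (f_n)_{n∈ℤ} of row vectors in ℝ_{≥0}^k whose first entry equals 1, such that γ_n·f_{n−1} = f_n·A_n for all n ∈ ℤ. Moreover, if (A_n)_{n∈ℤ} is periodic with period q, then (γ_n)_{n∈ℤ} and (f_n)_{n∈ℤ} are periodic with period q. -/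
/-- The product `A (j-1) * A (j-2) * ⋯ * A i` of a `ℤ`-indexed sequence of matrices
(the empty product being the identity). -/
def matProdZ (k : ℕ) (A : ℤ → Matrix (Fin k) (Fin k) ℕ) (i j : ℤ) :
    Matrix (Fin k) (Fin k) ℕ :=
  ((List.range (j - i).toNat).map (fun m => A (j - 1 - m))).prod

open Filter Topology in
theorem exists_tendsto_ultrafilter_of_eventually_mem_Icc {α : Type*} (F : Ultrafilter α)
    (x : α → ℝ) (a b : ℝ) (h : ∀ᶠ N in (F : Filter α), x N ∈ Set.Icc a b) :
    ∃ y, Tendsto x F (𝓝 y) := by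
  obtain ⟨y, -, hy⟩ := (isCompact_Icc (a := a) (b := b)).ultrafilter_le_nhds (F.map x)
    (le_principal_iff.2 h)
  exact ⟨y, hy⟩

section Comparable

variable {ι : Type*}

/-- `u` lies between two positive multiples of `v` whose ratio is at most `1 + D`. -/
def Comparable (D : ℝ) (u v : ι → ℝ) : Prop :=
  ∃ a b : ℝ, 0 < a ∧ b ≤ (1 + D) * a ∧ (∀ i, a * v i ≤ u i) ∧ ∀ i, u i ≤ b * v i

theorem Comparable.of_smul {D c d : ℝ} {u v : ι → ℝ} (hc : 0 < c) (hd : 0 < d)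
    (h : Comparable D (c • u) (d • v)) : Comparable D u v := by
  obtain ⟨a, b, ha, hab, hl, hu⟩ := h
  refine ⟨a * d / c, b * d / c, by positivity, ?_, fun i => ?_, fun i => ?_⟩
  · rw [div_le_iff₀ hc]
    have : (1 + D) * (a * d / c) * c = (1 + D) * a * d := by field_simp
    rw [this]
    gcongr
  · have := hl i
    simp only [Pi.smul_apply, smul_eq_mul] at this
    rw [div_mul_eq_mul_div, div_le_iff₀ hc]
    linarith
  · have := hu i
    simp only [Pi.smul_apply, smul_eq_mul] at this
    rw [div_mul_eq_mul_div, le_div_iff₀ hc]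
    linarith

theorem Comparable.mono {D E : ℝ} {u v : ι → ℝ} (hDE : D ≤ E) (h : Comparable D u v) :
    Comparable E u v := by
  obtain ⟨a, b, ha, hab, h⟩ := h
  exact ⟨a, b, ha, hab.trans (by gcongr), h⟩

theorem le_of_forall_comparable {u v : ι → ℝ} {o : ι} (hu : u o = 1) (hv : v o = 1)
    (hv0 : ∀ i, 0 ≤ v i) (h : ∀ ε > 0, Comparable ε u v) (i : ι) : u i ≤ v i := by
  refine le_of_forall_pos_le_add fun δ hδ => ?_
  obtain ⟨a, b, ha, hab, hl, hub⟩ := h (δ / (v i + 1)) (div_pos hδ (by linarith [hv0 i]))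
  have ha1 : a ≤ 1 := by simpa [hu, hv] using hl o
  have hε : 0 < δ / (v i + 1) := div_pos hδ (by linarith [hv0 i])
  have hb : b ≤ 1 + δ / (v i + 1) := hab.trans (mul_le_of_le_one_right (by linarith) ha1)
  have h1 : b * v i ≤ (1 + δ / (v i + 1)) * v i := mul_le_mul_of_nonneg_right hb (hv0 i)
  have h2 : δ / (v i + 1) * (v i + 1) = δ := div_mul_cancel₀ _ (by linarith [hv0 i])
  linarith [hub i]

variable [Fintype ι]

theorem Comparable.vecMul {D : ℝ} {u v : ι → ℝ} {M : Matrix ι ι ℝ} (hM : ∀ i j, 0 ≤ M i j)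
    (h : Comparable D u v) : Comparable D (Matrix.vecMul u M) (Matrix.vecMul v M) := by
  obtain ⟨a, b, ha, hab, hl, hu⟩ := h
  refine ⟨a, b, ha, hab, fun j => ?_, fun j => ?_⟩
  · simp only [Matrix.vecMul, dotProduct, Finset.mul_sum, ← mul_assoc]
    exact Finset.sum_le_sum fun i _ => mul_le_mul_of_nonneg_right (hl i) (hM i j)
  · simp only [Matrix.vecMul, dotProduct, Finset.mul_sum, ← mul_assoc]
    exact Finset.sum_le_sum fun i _ => mul_le_mul_of_nonneg_right (hu i) (hM i j)

theorem sum_le_vecMul {M : Matrix ι ι ℝ} {u : ι → ℝ} (hM : ∀ i j, 1 ≤ M i j)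
    (hu : ∀ i, 0 ≤ u i) (j : ι) : ∑ i, u i ≤ Matrix.vecMul u M j := by
  simp only [Matrix.vecMul, dotProduct]
  exact Finset.sum_le_sum fun i _ => le_mul_of_one_le_right (hu i) (hM i j)

theorem vecMul_le_mul_sum {C : ℝ} {M : Matrix ι ι ℝ} {u : ι → ℝ} (hM : ∀ i j, M i j ≤ C)
    (hu : ∀ i, 0 ≤ u i) (j : ι) : Matrix.vecMul u M j ≤ C * ∑ i, u i := by
  simp only [Matrix.vecMul, dotProduct, Finset.mul_sum]
  refine Finset.sum_le_sum fun i _ => ?_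
  rw [mul_comm C]
  exact mul_le_mul_of_nonneg_left (hM i j) (hu i)

/-- Matrices with entries in `[1, C]` contract the projective distance. -/
theorem Comparable.vecMul_contract {C D : ℝ} {u v : ι → ℝ} {M : Matrix ι ι ℝ} (hC : 1 ≤ C)
    (hD : 0 ≤ D) (hM : ∀ i j, 1 ≤ M i j) (hMC : ∀ i j, M i j ≤ C) (hv : ∀ i, 0 ≤ v i)
    (hpos : 0 < ∑ i, v i) (h : Comparable D u v) :
    Comparable (D * (1 - 1 / C)) (Matrix.vecMul u M) (Matrix.vecMul v M) := by
  obtain ⟨a, b, ha, hab, hl, hu⟩ := h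
  have hC0 : 0 < C := by linarith
  set S := ∑ i, u i with hS
  set T := ∑ i, v i with hT
  have hST : a * T ≤ S := by
    rw [hS, hT, Finset.mul_sum]
    exact Finset.sum_le_sum fun i _ => hl i
  have hST' : S ≤ b * T := by
    rw [hS, hT, Finset.mul_sum]
    exact Finset.sum_le_sum fun i _ => hu i
  have hθ : 0 ≤ 1 - 1 / C := by
    rw [sub_nonneg, div_le_one hC0]
    exact hC
  have ha' : 0 ≤ (S - a * T) / (C * T) := div_nonneg (by linarith) (by positivity)
  have hb' : 0 ≤ (b * T - S) / (C * T) := div_nonneg (by linarith) (by positivity)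
  refine ⟨a + (S - a * T) / (C * T), b - (b * T - S) / (C * T), by linarith, ?_,
    fun j => ?_, fun j => ?_⟩
  · have e : b - (b * T - S) / (C * T) =
        a + (S - a * T) / (C * T) + (b - a) * (1 - 1 / C) := by
      field_simp
      ring
    have h1 : (b - a) * (1 - 1 / C) ≤ D * a * (1 - 1 / C) :=
      mul_le_mul_of_nonneg_right (by linarith) hθ
    have h2 : 0 ≤ D * (1 - 1 / C) * ((S - a * T) / (C * T)) := by positivity
    rw [e]
    linarith
  · have h1 := sum_le_vecMul (u := u - a • v) hM (fun i => by simpa using hl i) j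
    have h2 := vecMul_le_mul_sum hMC hv j
    simp only [Matrix.sub_vecMul, Matrix.smul_vecMul, Pi.sub_apply, Pi.smul_apply, smul_eq_mul,
      Finset.sum_sub_distrib, ← Finset.mul_sum] at h1
    have h3 := mul_le_mul_of_nonneg_left h2 ha'
    rw [div_mul_cancel₀ _ (by positivity)] at h3
    linarith
  · have h1 := sum_le_vecMul (u := b • v - u) hM (fun i => by simpa using hu i) j
    have h2 := vecMul_le_mul_sum hMC hv j
    simp only [Matrix.sub_vecMul, Matrix.smul_vecMul, Pi.sub_apply, Pi.smul_apply, smul_eq_mul,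
      Finset.sum_sub_distrib, ← Finset.mul_sum] at h1
    have h3 := mul_le_mul_of_nonneg_left h2 hb'
    rw [div_mul_cancel₀ _ (by positivity)] at h3
    linarith

end Comparable

section Orbit

variable {ι : Type*} [Fintype ι] {o : ι} {B : ℤ → Matrix ι ι ℝ} {N : ℤ} {f g : ℤ → ι → ℝ}

/-- Nonnegative vectors with `o`-entry `1` satisfying the projective recursion
`f (n - 1) ∝ f n * B n` at all `n ≤ N`. -/
structure IsOrbitUpTo (o : ι) (B : ℤ → Matrix ι ι ℝ) (N : ℤ) (f : ℤ → ι → ℝ) : Prop where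
  nonneg : ∀ n i, 0 ≤ f n i
  normalized : ∀ n, f n o = 1
  step : ∀ n ≤ N, Matrix.vecMul (f n) (B n) o • f (n - 1) = Matrix.vecMul (f n) (B n)

theorem one_le_vecMul_apply {M : Matrix ι ι ℝ} {u : ι → ℝ} (hM : ∀ i j, 0 ≤ M i j)
    (ho : 1 ≤ M o o) (hu : ∀ i, 0 ≤ u i) (huo : u o = 1) : 1 ≤ Matrix.vecMul u M o := by
  have : u o * M o o ≤ ∑ i, u i * M i o :=
    Finset.single_le_sum (f := fun i => u i * M i o) (fun i _ => mul_nonneg (hu i) (hM i o))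
      (Finset.mem_univ o)
  rw [huo, one_mul] at this
  simpa only [Matrix.vecMul, dotProduct] using ho.trans this

theorem IsOrbitUpTo.sum_pos (hf : IsOrbitUpTo o B N f) (n : ℤ) : 0 < ∑ i, f n i := by
  have := Finset.single_le_sum (f := f n) (fun i _ => hf.nonneg n i) (Finset.mem_univ o)
  linarith [hf.normalized n]

theorem IsOrbitUpTo.one_le (hB : ∀ n i j, 0 ≤ B n i j) (ho : ∀ n, 1 ≤ B n o o)
    (hf : IsOrbitUpTo o B N f) (n : ℤ) : 1 ≤ Matrix.vecMul (f n) (B n) o :=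
  one_le_vecMul_apply (hB n) (ho n) (hf.nonneg n) (hf.normalized n)

theorem IsOrbitUpTo.exists_smul_eq_vecMul_prod [DecidableEq ι] (hB : ∀ n i j, 0 ≤ B n i j)
    (ho : ∀ n, 1 ≤ B n o o) (hf : IsOrbitUpTo o B N f) {j : ℤ} (hj : j - 1 ≤ N) (m : ℕ) :
    ∃ c : ℝ, 0 < c ∧ c • f (j - 1 - m) =
      Matrix.vecMul (f (j - 1)) ((List.range m).map fun l : ℕ => B (j - 1 - l)).prod := by
  induction m with
  | zero => exact ⟨1, one_pos, by simp⟩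
  | succ m ih =>
    obtain ⟨c, hc, h⟩ := ih
    have hγ := hf.one_le hB ho (j - 1 - m)
    refine ⟨c * Matrix.vecMul (f (j - 1 - m)) (B (j - 1 - m)) o, by positivity, ?_⟩
    rw [List.range_succ, List.map_append, List.prod_append, ← Matrix.vecMul_vecMul, ← h]
    have e : j - 1 - ((m + 1 : ℕ) : ℤ) = j - 1 - m - 1 := by push_cast; ring
    rw [e, mul_smul, hf.step _ (by omega)]
    simp [Matrix.smul_vecMul]

theorem IsOrbitUpTo.comparable_of_le {D : ℝ} (hB : ∀ n i j, 0 ≤ B n i j)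
    (ho : ∀ n, 1 ≤ B n o o) (hf : IsOrbitUpTo o B N f) (hg : IsOrbitUpTo o B N g) {m n : ℤ}
    (hm : m ≤ N) (h : Comparable D (f m) (g m)) (hn : n ≤ m) : Comparable D (f n) (g n) := by
  induction n, hn using Int.leInductionDown with
  | base => exact h
  | pred n hn ih =>
    have h1 := hf.one_le hB ho n
    have h2 := hg.one_le hB ho n
    refine Comparable.of_smul (c := Matrix.vecMul (f n) (B n) o)
      (d := Matrix.vecMul (g n) (B n) o) (by linarith) (by linarith) ?_
    rw [hf.step n (by omega), hg.step n (by omega)]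
    exact ih.vecMul (hB n)

theorem IsOrbitUpTo.exists_bound (hB : ∀ n i j, 0 ≤ B n i j) (ho : ∀ n, 1 ≤ B n o o) {K : ℤ}
    {b : ℝ} (hK : K ≤ N) (hb : ∀ N' ≥ N, ∀ f, IsOrbitUpTo o B N' f → ∀ i, f K i ≤ b) {n : ℤ}
    (hn : n ≤ K) : ∃ b, ∀ N' ≥ N, ∀ f, IsOrbitUpTo o B N' f → ∀ i, f n i ≤ b := by
  induction n, hn using Int.leInductionDown with
  | base => exact ⟨b, hb⟩
  | pred n hn ih =>
    obtain ⟨b, hb⟩ := ih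
    refine ⟨∑ j, ∑ i, b * B n i j, fun N' hN' f hf j => ?_⟩
    have hb0 : 0 ≤ b := (hf.nonneg n o).trans (hb N' hN' f hf o)
    have h1 := hf.one_le hB ho n
    have h2 : Matrix.vecMul (f n) (B n) o * f (n - 1) j = Matrix.vecMul (f n) (B n) j :=
      congrFun (hf.step n (by omega)) j
    calc f (n - 1) j ≤ Matrix.vecMul (f n) (B n) j := by
          rw [← h2]
          exact le_mul_of_one_le_left (hf.nonneg _ _) h1
      _ ≤ ∑ i, b * B n i j :=
          Finset.sum_le_sum fun i _ => mul_le_mul_of_nonneg_right (hb N' hN' f hf i) (hB n i j)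
      _ ≤ ∑ j, ∑ i, b * B n i j :=
          Finset.single_le_sum (f := fun j => ∑ i, b * B n i j)
            (fun j _ => Finset.sum_nonneg fun i _ => mul_nonneg hb0 (hB n i j))
            (Finset.mem_univ j)

theorem exists_isOrbitUpTo [DecidableEq ι] (hB : ∀ n i j, 0 ≤ B n i j)
    (ho : ∀ n, 1 ≤ B n o o) (N : ℤ) : ∃ f, IsOrbitUpTo o B N f := by
  let u : ℕ → ι → ℝ := fun m => Nat.rec (Pi.single o 1)
    (fun m v => (Matrix.vecMul v (B (N - m)) o)⁻¹ • Matrix.vecMul v (B (N - m))) m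
  have hsucc (m : ℕ) : u (m + 1) =
      (Matrix.vecMul (u m) (B (N - m)) o)⁻¹ • Matrix.vecMul (u m) (B (N - m)) := rfl
  have hu (m : ℕ) : (∀ i, 0 ≤ u m i) ∧ u m o = 1 := by
    induction m with
    | zero =>
      refine ⟨fun i => ?_, Pi.single_eq_same (M := fun _ : ι => ℝ) o 1⟩
      exact (Pi.single_nonneg.2 zero_le_one : (0 : ι → ℝ) ≤ Pi.single o 1) i
    | succ m ih =>
      have h1 := one_le_vecMul_apply (hB (N - m)) (ho _) ih.1 ih.2
      rw [hsucc]
      refine ⟨fun i => mul_nonneg (by positivity) ?_, inv_mul_cancel₀ (by positivity)⟩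
      exact Finset.sum_nonneg fun l _ => mul_nonneg (ih.1 l) (hB _ l i)
  refine ⟨fun n => u (N - n).toNat, fun n => (hu _).1, fun n => (hu _).2, fun n hn => ?_⟩
  have h1 := one_le_vecMul_apply (hB n) (ho _) (hu (N - n).toNat).1 (hu (N - n).toNat).2
  have e : (N - (n - 1)).toNat = (N - n).toNat + 1 := by omega
  have e' : N - ((N - n).toNat : ℤ) = n := by omega
  rw [e, hsucc, e', smul_smul, mul_inv_cancel₀ (by positivity), one_smul]

end Orbit

section Blocks

variable {ι : Type*} [Fintype ι] [DecidableEq ι] {o : ι} {B : ℤ → Matrix ι ι ℝ} {N : ℤ}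
  {f g : ℤ → ι → ℝ} {C : ℝ} {P : Matrix ι ι ℝ} {s t : ℤ}

theorem IsOrbitUpTo.exists_smul_eq_vecMul_of_prod_eq (hB : ∀ n i j, 0 ≤ B n i j)
    (ho : ∀ n, 1 ≤ B n o o) (hst : s ≤ t)
    (hprod : ((List.range (t - s).toNat).map fun l : ℕ => B (t - 1 - l)).prod = P)
    (hf : IsOrbitUpTo o B N f) (ht : t - 1 ≤ N) :
    ∃ c : ℝ, 0 < c ∧ c • f (s - 1) = Matrix.vecMul (f (t - 1)) P := by
  obtain ⟨c, hc, h⟩ := hf.exists_smul_eq_vecMul_prod hB ho ht (t - s).toNat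
  have e : t - 1 - ((t - s).toNat : ℤ) = s - 1 := by omega
  exact ⟨c, hc, by rw [← hprod, ← h, e]⟩

theorem IsOrbitUpTo.bounds_of_prod_eq (hB : ∀ n i j, 0 ≤ B n i j) (ho : ∀ n, 1 ≤ B n o o)
    (hP : ∀ i j, 1 ≤ P i j) (hPC : ∀ i j, P i j ≤ C) (hC : 1 ≤ C) (hst : s ≤ t)
    (hprod : ((List.range (t - s).toNat).map fun l : ℕ => B (t - 1 - l)).prod = P)
    (hf : IsOrbitUpTo o B N f) (ht : t - 1 ≤ N) (i : ι) :
    f (s - 1) i ≤ C ∧ 1 ≤ C * f (s - 1) i := by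
  obtain ⟨c, hc, h⟩ := hf.exists_smul_eq_vecMul_of_prod_eq hB ho hst hprod ht
  have hS := hf.sum_pos (t - 1)
  set S := ∑ i, f (t - 1) i
  have hl (j : ι) : S ≤ c * f (s - 1) j := by
    have := sum_le_vecMul hP (hf.nonneg (t - 1)) j
    rwa [← h] at this
  have hu (j : ι) : c * f (s - 1) j ≤ C * S := by
    have := vecMul_le_mul_sum hPC (hf.nonneg (t - 1)) j
    rwa [← h] at this
  have hl0 := hl o
  have hu0 := hu o
  rw [hf.normalized, mul_one] at hl0 hu0
  constructor
  · refine le_of_mul_le_mul_left ((hu i).trans ?_) hc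
    rw [mul_comm c]
    exact mul_le_mul_of_nonneg_left hl0 (by linarith)
  · refine le_of_mul_le_mul_left ?_ hc
    have := mul_le_mul_of_nonneg_left (hl i) (by linarith : 0 ≤ C)
    linarith

end Blocks

section Recurrent

variable {ι : Type*} [Fintype ι] [DecidableEq ι] {o : ι} {B : ℤ → Matrix ι ι ℝ}
  {f g : ℤ → ι → ℝ} {C : ℝ} {P : Matrix ι ι ℝ} {s t : ℕ → ℕ}

theorem le_of_interlaced (hst : ∀ r, s r < t r) (hts : ∀ r, t r ≤ s (r + 1)) (r : ℕ) :
    r ≤ s r := by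
  induction r with
  | zero => exact Nat.zero_le _
  | succ r ih =>
    have := hst r
    have := hts r
    omega

open Filter Topology in
theorem exists_forall_isOrbitUpTo (hB : ∀ n i j, 0 ≤ B n i j) (ho : ∀ n, 1 ≤ B n o o)
    (hP : ∀ i j, 1 ≤ P i j) (hPC : ∀ i j, P i j ≤ C) (hC : 1 ≤ C) (hst : ∀ r, s r < t r)
    (hts : ∀ r, t r ≤ s (r + 1))
    (hprod : ∀ r, ((List.range ((t r : ℤ) - s r).toNat).map
      fun l : ℕ => B ((t r : ℤ) - 1 - l)).prod = P) :
    ∃ f, ∀ N, IsOrbitUpTo o B N f := by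
  choose F hF using fun N : ℕ => exists_isOrbitUpTo (o := o) hB ho (N : ℤ)
  have hbound (n : ℤ) : ∃ b, ∃ M : ℤ, ∀ N' ≥ M, ∀ f, IsOrbitUpTo o B N' f → ∀ i, f n i ≤ b := by
    have h1 := le_of_interlaced hst hts (n + 1).toNat
    set r := (n + 1).toNat with hr
    have h2 := hst r
    obtain ⟨b, hb⟩ := IsOrbitUpTo.exists_bound (o := o) (B := B) (N := (t r : ℤ) - 1)
      (K := (s r : ℤ) - 1) (b := C) (n := n) hB ho (by omega)
      (fun N' hN' f hf i => (hf.bounds_of_prod_eq hB ho hP hPC hC (by omega) (hprod r)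
        (by omega) i).1) (by omega)
    exact ⟨b, _, hb⟩
  have hlim (n : ℤ) (i : ι) : ∃ y, Tendsto (fun N => F N n i) (hyperfilter ℕ) (𝓝 y) := by
    obtain ⟨b, M, hb⟩ := hbound n
    refine exists_tendsto_ultrafilter_of_eventually_mem_Icc _ _ 0 b ?_
    refine Filter.Eventually.filter_mono Nat.hyperfilter_le_atTop ?_
    filter_upwards [eventually_ge_atTop M.toNat] with N hN
    exact ⟨(hF N).nonneg n i, hb N (by omega) _ (hF N) i⟩
  choose f hf using hlim
  have hmul (n : ℤ) (j : ι) : Tendsto (fun N => Matrix.vecMul (F N n) (B n) j) (hyperfilter ℕ)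
      (𝓝 (Matrix.vecMul (f n) (B n) j)) :=
    tendsto_finsetSum _ fun i _ => (hf n i).mul_const _
  refine ⟨f, fun _ => ⟨fun n i => ?_, fun n => ?_, fun n _ => ?_⟩⟩
  · exact ge_of_tendsto' (hf n i) fun N => (hF N).nonneg n i
  · refine tendsto_nhds_unique (hf n o) ?_
    simp only [(hF _).normalized]
    exact tendsto_const_nhds
  · ext j
    refine tendsto_nhds_unique_of_eventuallyEq ((hmul n o).mul (hf (n - 1) j)) (hmul n j) ?_
    refine Filter.Eventually.filter_mono Nat.hyperfilter_le_atTop ?_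
    filter_upwards [eventually_ge_atTop n.toNat] with N hN
    exact congrFun ((hF N).step n (by omega)) j

theorem comparable_pow_of_isOrbitUpTo (hB : ∀ n i j, 0 ≤ B n i j) (ho : ∀ n, 1 ≤ B n o o)
    (hP : ∀ i j, 1 ≤ P i j) (hPC : ∀ i j, P i j ≤ C) (hC : 1 ≤ C) (hst : ∀ r, s r < t r)
    (hts : ∀ r, t r ≤ s (r + 1))
    (hprod : ∀ r, ((List.range ((t r : ℤ) - s r).toNat).map
      fun l : ℕ => B ((t r : ℤ) - 1 - l)).prod = P)
    (hf : ∀ N, IsOrbitUpTo o B N f) (hg : ∀ N, IsOrbitUpTo o B N g) (m r : ℕ) :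
    Comparable (C ^ 4 * (1 - 1 / C) ^ m) (f (s r - 1)) (g (s r - 1)) := by
  have hC0 : 0 < C := by linarith
  have hθ : 0 ≤ 1 - 1 / C := by
    rw [sub_nonneg, div_le_one hC0]
    exact hC
  induction m generalizing r with
  | zero =>
    have hb (f) (hf : ∀ N, IsOrbitUpTo o B N f) := (hf (t r - 1)).bounds_of_prod_eq hB ho hP hPC
      hC (by exact_mod_cast (hst r).le) (hprod r) le_rfl
    refine ⟨1 / C ^ 2, C ^ 2, by positivity, ?_, fun i => ?_, fun i => ?_⟩
    · have : (1 + C ^ 4 * (1 - 1 / C) ^ 0) * (1 / C ^ 2) = C ^ 2 + 1 / C ^ 2 := by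
        field_simp
        ring
      rw [this]
      have : 0 < 1 / C ^ 2 := by positivity
      linarith
    · rw [div_mul_eq_mul_div, div_le_iff₀ (by positivity)]
      have := (hb g hg i).1
      have := mul_le_mul_of_nonneg_left (hb f hf i).2 hC0.le
      linarith
    · have := (hb f hf i).1
      have := mul_le_mul_of_nonneg_left (hb g hg i).2 hC0.le
      linarith
  | succ m ih =>
    have hst' : (s r : ℤ) ≤ t r := by exact_mod_cast (hst r).le
    have hts' : (t r : ℤ) ≤ s (r + 1) := by exact_mod_cast hts r
    have h := (hf (s (r + 1) - 1)).comparable_of_le hB ho (hg _) le_rfl (ih (r + 1))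
      (n := (t r : ℤ) - 1) (by omega)
    obtain ⟨c, hc, hfc⟩ := (hf (t r - 1)).exists_smul_eq_vecMul_of_prod_eq hB ho hst' (hprod r)
      le_rfl
    obtain ⟨d, hd, hgd⟩ := (hg (t r - 1)).exists_smul_eq_vecMul_of_prod_eq hB ho hst' (hprod r)
      le_rfl
    refine Comparable.of_smul hc hd ?_
    rw [hfc, hgd, pow_succ (1 - 1 / C), ← mul_assoc]
    exact h.vecMul_contract hC (by positivity) hP hPC ((hg 0).nonneg _) ((hg 0).sum_pos _)

theorem le_of_forall_isOrbitUpTo (hB : ∀ n i j, 0 ≤ B n i j) (ho : ∀ n, 1 ≤ B n o o)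
    (hP : ∀ i j, 1 ≤ P i j) (hPC : ∀ i j, P i j ≤ C) (hC : 1 ≤ C) (hst : ∀ r, s r < t r)
    (hts : ∀ r, t r ≤ s (r + 1))
    (hprod : ∀ r, ((List.range ((t r : ℤ) - s r).toNat).map
      fun l : ℕ => B ((t r : ℤ) - 1 - l)).prod = P)
    (hf : ∀ N, IsOrbitUpTo o B N f) (hg : ∀ N, IsOrbitUpTo o B N g) : f ≤ g := by
  intro n
  refine le_of_forall_comparable ((hf 0).normalized n) ((hg 0).normalized n)
    ((hg 0).nonneg n) fun ε hε => ?_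
  have hC0 : 0 < C := by linarith
  have hθ : 0 ≤ 1 - 1 / C := by
    rw [sub_nonneg, div_le_one hC0]
    exact hC
  have hθ1 : 1 - 1 / C < 1 := by
    have : 0 < 1 / C := by positivity
    linarith
  obtain ⟨m, hm⟩ := exists_pow_lt_of_lt_one (show 0 < ε / C ^ 4 by positivity) hθ1
  rw [lt_div_iff₀ (by positivity)] at hm
  have h1 := le_of_interlaced hst hts (n + 1).toNat
  have h2 := comparable_pow_of_isOrbitUpTo hB ho hP hPC hC hst hts hprod hf hg m (n + 1).toNat
  exact (hf _).comparable_of_le hB ho (hg _) le_rfl (h2.mono (by linarith)) (by omega)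

end Recurrent

theorem stmt9 (k : ℕ) (hk : 1 ≤ k) (A : ℤ → Matrix (Fin k) (Fin k) ℕ)
    (hA11 : ∀ n : ℤ, 1 ≤ A n ⟨0, by omega⟩ ⟨0, by omega⟩)
    (P : Matrix (Fin k) (Fin k) ℕ) (hP : ∀ i j, 0 < P i j)
    (idx jdx : ℕ → ℕ)
    (hij : ∀ r, idx r < jdx r) (hji : ∀ r, jdx r ≤ idx (r + 1))
    (hprod : ∀ r, matProdZ k A (idx r) (jdx r) = P) :
    (∃! gf : (ℤ → ℝ) × (ℤ → Fin k → ℝ),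
      (∀ n, 0 < gf.1 n) ∧ (∀ n i, 0 ≤ gf.2 n i) ∧
      (∀ n, gf.2 n ⟨0, by omega⟩ = 1) ∧
      (∀ n : ℤ, gf.1 n • gf.2 (n - 1) =
        Matrix.vecMul (gf.2 n) ((A n).map (Nat.cast : ℕ → ℝ)))) ∧
    (∀ q : ℕ, 0 < q → (∀ n : ℤ, A (n + q) = A n) →
      ∀ γ : ℤ → ℝ, ∀ f : ℤ → Fin k → ℝ,
        (∀ n, 0 < γ n) → (∀ n i, 0 ≤ f n i) → (∀ n, f n ⟨0, by omega⟩ = 1) →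
        (∀ n : ℤ, γ n • f (n - 1) = Matrix.vecMul (f n) ((A n).map (Nat.cast : ℕ → ℝ))) →
        (∀ n : ℤ, γ (n + q) = γ n) ∧ (∀ n : ℤ, f (n + q) = f n)) := by
  classical
  set o : Fin k := ⟨0, by omega⟩ with ho_def
  set B : ℤ → Matrix (Fin k) (Fin k) ℝ := fun n => (A n).map (Nat.cast : ℕ → ℝ) with hB_def
  have hB (n : ℤ) (i j : Fin k) : 0 ≤ B n i j := Nat.cast_nonneg _
  have ho (n : ℤ) : 1 ≤ B n o o := Nat.one_le_cast.2 (hA11 n)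
  set P' : Matrix (Fin k) (Fin k) ℝ := P.map (Nat.cast : ℕ → ℝ) with hP'_def
  have hP' (i j : Fin k) : 1 ≤ P' i j := Nat.one_le_cast.2 (hP i j)
  obtain ⟨C, hPC⟩ : ∃ C, ∀ i j, P' i j ≤ C := by
    obtain ⟨C, hC⟩ := (Set.finite_range fun x : Fin k × Fin k => P' x.1 x.2).bddAbove
    exact ⟨C, fun i j => hC ⟨(i, j), rfl⟩⟩
  have hC : 1 ≤ C := (hP' o o).trans (hPC o o)
  have hprod' (r : ℕ) : ((List.range ((jdx r : ℤ) - idx r).toNat).map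
      fun l : ℕ => B ((jdx r : ℤ) - 1 - l)).prod = P' := by
    have h := congrArg (Nat.castRingHom ℝ).mapMatrix (hprod r)
    rw [matProdZ, map_list_prod, List.map_map] at h
    simp only [List.pure_def, List.bind_eq_flatMap, List.map_eq_flatMap,
      List.flatMap_assoc] at h ⊢
    exact h
  have orbit_of (γ : ℤ → ℝ) (f : ℤ → Fin k → ℝ) (h0 : ∀ n i, 0 ≤ f n i) (h1 : ∀ n, f n o = 1)
      (h : ∀ n, γ n • f (n - 1) = Matrix.vecMul (f n) (B n)) :
      (∀ n, γ n = Matrix.vecMul (f n) (B n) o) ∧ ∀ N, IsOrbitUpTo o B N f := by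
    have hγ (n : ℤ) : γ n = Matrix.vecMul (f n) (B n) o := by
      rw [← h n, Pi.smul_apply, h1, smul_eq_mul, mul_one]
    exact ⟨hγ, fun N => ⟨h0, h1, fun n _ => by rw [← hγ, h]⟩⟩
  have unique {f g : ℤ → Fin k → ℝ} (hf : ∀ N, IsOrbitUpTo o B N f)
      (hg : ∀ N, IsOrbitUpTo o B N g) : f = g :=
    le_antisymm (le_of_forall_isOrbitUpTo hB ho hP' hPC hC hij hji hprod' hf hg)
      (le_of_forall_isOrbitUpTo hB ho hP' hPC hC hij hji hprod' hg hf)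
  constructor
  · obtain ⟨f, hf⟩ := exists_forall_isOrbitUpTo (o := o) hB ho hP' hPC hC hij hji hprod'
    refine ⟨(fun n => Matrix.vecMul (f n) (B n) o, f), ⟨fun n => ?_, (hf 0).nonneg,
      (hf 0).normalized, fun n => (hf n).step n le_rfl⟩, ?_⟩
    · exact one_pos.trans_le ((hf 0).one_le hB ho n)
    · rintro ⟨γ, g⟩ ⟨-, h0, h1, h⟩
      obtain ⟨hγ, hg⟩ := orbit_of γ g h0 h1 h
      obtain rfl := unique hg hf
      exact Prod.ext (funext hγ) rfl
  · intro q _ hq γ f _ h0 h1 h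
    obtain ⟨hγ, hf⟩ := orbit_of γ f h0 h1 h
    have hBq (n : ℤ) : B (n + q) = B n := by rw [hB_def]; dsimp only; rw [hq]
    have hshift : ∀ N, IsOrbitUpTo o B N fun n => f (n + q) := by
      refine (orbit_of (fun n => γ (n + q)) _ (fun n => h0 _) (fun n => h1 _) fun n => ?_).2
      rw [← hBq n, ← h (n + q), sub_add_eq_add_sub]
    have hfq (n : ℤ) : f (n + q) = f n := congrFun (unique hshift hf) n
    exact ⟨fun n => by rw [hγ, hγ, hfq, hBq], hfq⟩
end
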